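/- For every n ≥ 1, the number of parking functions of length n equals (n+1)^{n−1}. -/

import Mathlib

/-- A parking function of length `n` is a sequence of positive integers
`(i_1, …, i_n)` such that its nondecreasing rearrangement `j_1 ≤ … ≤ j_n`
satisfies `1 ≤ j_k ≤ k` for every `k`. -/
def IsParkingFunction {n : ℕ} (f : Fin n → ℕ) : Prop :=
  ∃ σ : Equiv.Perm (Fin n),
    Monotone (f ∘ σ) ∧ ∀ k : Fin n, 1 ≤ f (σ k) ∧ f (σ k) ≤ (k : ℕ) + 1


theorem pf_iff {n : ℕ} (f : Fin n → ℕ) : IsParkingFunction f ↔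
    (∀ i, 1 ≤ f i) ∧ ∀ k ≤ n, k ≤ (Finset.univ.filter (fun i => f i ≤ k)).card := by
  constructor
  · rintro ⟨σ, hm, h⟩
    refine ⟨fun i => ?_, fun k hk => ?_⟩
    · have := (h (σ.symm i)).1
      simpa using this
    · have h1 : (Finset.univ.filter (fun i : Fin n => (i : ℕ) < k)).card = k := by
        rw [Fin.card_filter_val_lt]; omega
      calc k = _ := h1.symm
        _ ≤ _ := by
          apply Finset.card_le_card_of_injOn σ
          · intro i hi
            simp at hi ⊢
            have := (h i).2
            omega
          · exact σ.injective.injOn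
  · rintro ⟨h1, h2⟩
    refine ⟨Tuple.sort f, Tuple.monotone_sort f, fun k => ⟨h1 _, ?_⟩⟩
    by_contra hc
    have h3 := h2 (k + 1) (by omega)
    have h4 : (Finset.univ.filter (fun i => f i ≤ (k : ℕ) + 1)).card
        ≤ (Finset.univ.filter (fun i : Fin n => (i : ℕ) < k)).card := by
      apply Finset.card_le_card_of_injOn (Tuple.sort f).symm
      · intro i hi
        simp at hi ⊢
        by_contra hlt
        have := Tuple.monotone_sort f (not_lt.mp hlt)
        simp at this
        omega
      · exact (Tuple.sort f).symm.injective.injOn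
    rw [Fin.card_filter_val_lt] at h4
    omega

/-- Parking condition for zero-based preferences modulo `n + 1`. -/
def ParkMod {n : ℕ} (g : Fin n → ZMod (n + 1)) : Prop :=
  ∀ k ≤ n, k ≤ (Finset.univ.filter (fun i => (g i).val < k)).card

/-- Cumulative number of preferences on the unrolled circle. -/
def cumul {n : ℕ} (g : Fin n → ZMod (n + 1)) (m : ℕ) : ℕ :=
  ∑ j ∈ Finset.range m, (Finset.univ.filter (fun i => g i = (j : ZMod (n + 1)))).card

theorem cumul_add {n : ℕ} (g : Fin n → ZMod (n + 1)) (c k : ℕ) (hk : k ≤ n + 1) :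
    cumul g (c + k) = cumul g c +
      (Finset.univ.filter (fun i => (g i - (c : ZMod (n + 1))).val < k)).card := by
  unfold cumul
  rw [Finset.sum_range_add]
  congr 1
  rw [Finset.card_eq_sum_card_fiberwise (f := fun i => (g i - (c : ZMod (n + 1))).val)
    (t := Finset.range k) (by intro i hi; simpa using hi)]
  refine Finset.sum_congr rfl fun j hj => ?_
  have hj' : j < k := by simpa using hj
  have hv : ((j : ZMod (n + 1))).val = j := ZMod.val_cast_of_lt (by omega)
  congr 1
  ext i
  simp only [Finset.mem_filter, Finset.mem_univ, true_and]
  constructor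
  · intro h
    have : g i - (c : ZMod (n + 1)) = j := by rw [h]; push_cast; ring
    rw [this, hv]
    exact ⟨hj', rfl⟩
  · rintro ⟨_, h⟩
    have : g i - (c : ZMod (n + 1)) = j := ZMod.val_injective _ (by rw [h, hv])
    push_cast
    rw [← this]; ring

theorem cumul_period {n : ℕ} (g : Fin n → ZMod (n + 1)) (c : ℕ) :
    cumul g (c + (n + 1)) = cumul g c + n := by
  rw [cumul_add g c (n + 1) le_rfl]
  congr 1
  rw [Finset.filter_true_of_mem (fun i _ => ZMod.val_lt _)]
  simp

theorem parkMod_iff {n : ℕ} (g : Fin n → ZMod (n + 1)) (c : ℕ) :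
    ParkMod (fun i => g i - (c : ZMod (n + 1))) ↔
      ∀ k ≤ n, cumul g c + k ≤ cumul g (c + k) := by
  unfold ParkMod
  refine forall₂_congr fun k hk => ?_
  rw [cumul_add g c k (by omega)]
  beta_reduce
  omega

theorem exists_unique_shift {n : ℕ} (g : Fin n → ZMod (n + 1)) :
    ∃! c : ZMod (n + 1), ParkMod (fun i => g i - c) := by
  have key : ∃ c < n + 1, ∀ k ≤ n, cumul g c + k ≤ cumul g (c + k) := by
    -- first minimizer of `cumul g m - m`
    obtain ⟨c, hc, hmin⟩ := Finset.exists_min_image (Finset.range (n + 1))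
      (fun m => ((cumul g m : ℤ) - m) * (n + 1) + m) ⟨0, by simp⟩
    have hc' : c < n + 1 := by simpa using hc
    refine ⟨c, hc', fun k hk => ?_⟩
    by_cases h : c + k < n + 1
    · have h1 := hmin (c + k) (by simpa using h)
      by_contra hlt
      push Not at hlt
      have h2 : (cumul g (c + k) : ℤ) + 1 ≤ cumul g c + k := by exact_mod_cast hlt
      push_cast at h1
      nlinarith
    · obtain ⟨m, hm⟩ : ∃ m, c + k = m + (n + 1) := ⟨c + k - (n + 1), by omega⟩
      rw [hm, cumul_period]
      have hmc : m < c := by omega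
      have h1 := hmin m (by simp; omega)
      by_contra hlt
      push Not at hlt
      have h2 : (cumul g m : ℤ) + n + 1 ≤ cumul g c + k := by exact_mod_cast hlt
      have h3 : (c : ℤ) + k = m + (n + 1) := by exact_mod_cast hm
      have h4 : (m : ℤ) < c := by exact_mod_cast hmc
      have h5 : (cumul g m : ℤ) - m ≤ cumul g c - c := by linarith
      nlinarith
  obtain ⟨c, hc, h⟩ := key
  refine ⟨(c : ZMod (n + 1)), (parkMod_iff g c).2 h, fun d hd => ?_⟩
  have hdv : ((d.val : ℕ) : ZMod (n + 1)) = d := ZMod.natCast_zmod_val d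
  rw [← hdv] at hd ⊢
  have hd' := (parkMod_iff g d.val).1 hd
  have hdl : d.val < n + 1 := ZMod.val_lt d
  generalize d.val = e at *
  have aux : ∀ a b : ℕ, a < b → b < n + 1 →
      (∀ k ≤ n, cumul g a + k ≤ cumul g (a + k)) →
      (∀ k ≤ n, cumul g b + k ≤ cumul g (b + k)) → False := by
    intro a b hab hb ha hb'
    have h1 := ha (b - a) (by omega)
    have h2 := hb' (a + (n + 1) - b) (by omega)
    rw [show b + (a + (n + 1) - b) = a + (n + 1) by omega, cumul_period] at h2
    rw [show a + (b - a) = b by omega] at h1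
    omega
  rcases lt_trichotomy e c with h1 | h1 | h1
  · exact (aux e c h1 hc hd' h).elim
  · rw [h1]
  · exact (aux c e h1 hdl h hd').elim

theorem card_parkMod (n : ℕ) :
    Nat.card {g : Fin n → ZMod (n + 1) // ParkMod g} * (n + 1) = (n + 1) ^ n := by
  have hb : Function.Bijective
      (fun p : {g : Fin n → ZMod (n + 1) // ParkMod g} × ZMod (n + 1) =>
        (fun i => p.1.1 i + p.2 : Fin n → ZMod (n + 1))) := by
    constructor
    · rintro ⟨⟨g, hg⟩, c⟩ ⟨⟨g', hg'⟩, c'⟩ h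
      have h' : ∀ i, g i + c = g' i + c' := fun i => congrFun h i
      have hcc : c = c' := by
        apply (exists_unique_shift (fun i => g i + c)).unique
        · simpa using hg
        · simp only [h']
          simpa using hg'
      subst hcc
      have : g = g' := funext fun i => by simpa using h' i
      subst this
      rfl
    · intro g
      obtain ⟨c, hc, _⟩ := exists_unique_shift g
      exact ⟨⟨⟨_, hc⟩, c⟩, by simp⟩
  have := Nat.card_congr (Equiv.ofBijective _ hb)
  rw [Nat.card_prod, Nat.card_fun] at this
  simpa using this

theorem card_pf_eq (n : ℕ) : Nat.card {f : Fin n → ℕ // IsParkingFunction f} =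
    Nat.card {g : Fin n → ZMod (n + 1) // ParkMod g} := by
  symm
  apply Nat.card_congr
  refine Equiv.ofBijective (fun g => ⟨fun i => (g.1 i).val + 1, ?_⟩) ⟨?_, ?_⟩
  · rw [pf_iff]
    exact ⟨fun i => by omega, fun k hk => g.2 k hk⟩
  · rintro ⟨g, hg⟩ ⟨g', hg'⟩ h
    simp only [Subtype.mk.injEq] at h ⊢
    funext i
    have := congrFun h i
    exact ZMod.val_injective _ (by simpa using this)
  · rintro ⟨f, hf⟩
    obtain ⟨h1, h2⟩ := (pf_iff f).1 hf
    have hle : ∀ i, f i ≤ n := by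
      have h3 := h2 n le_rfl
      have h4 : (Finset.univ.filter (fun i => f i ≤ n)) = Finset.univ := by
        apply Finset.eq_univ_of_card
        apply le_antisymm (Finset.card_le_univ _)
        simpa using h3
      intro i
      have : i ∈ Finset.univ.filter (fun i => f i ≤ n) := by rw [h4]; simp
      simpa using this
    have hv : ∀ i, (((f i - 1 : ℕ) : ZMod (n + 1))).val + 1 = f i := fun i => by
      have := h1 i
      have := hle i
      rw [ZMod.val_cast_of_lt (by omega)]
      omega
    refine ⟨⟨fun i => ((f i - 1 : ℕ) : ZMod (n + 1)), fun k hk => ?_⟩, ?_⟩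
    · convert h2 k hk using 4 with i
      have := hv i
      beta_reduce
      omega
    · simp only [Subtype.mk.injEq]
      exact funext hv

/-- for every `n ≥ 1`, the number of parking functions of length
`n` equals `(n+1)^{n-1}`. -/
theorem card_parkingFunction (n : ℕ) (hn : 1 ≤ n) :
    Nat.card {f : Fin n → ℕ // IsParkingFunction f} = (n + 1) ^ (n - 1) := by
  rw [card_pf_eq]
  have h := card_parkMod n
  obtain ⟨m, rfl⟩ : ∃ m, n = m + 1 := ⟨n - 1, by omega⟩
  rw [pow_succ] at h
  simpa using Nat.eq_of_mul_eq_mul_right (by omega) h
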